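/- arXiv:1911.02643 — 2 statements merged into one kernel-verified Lean document; each statement's English description precedes it below -/
import Mathlib

section
/- Let a, b ∈ ℝ, c ≥ 0, let μ be a nonnegative measure on (0,∞) such that for every x > 0 the integral ∫₀^∞ (t·x − log(1+t·x)) dμ(t) is finite, and define f(x) := a + b·x − c·log x + ∫₀^∞ (t·x − log(1+t·x)) dμ(t) for x > 0. Define Δ_f(X,Y) := (1/2)·tr f(X) + (1/2)·tr f(Y) − tr f((X+Y)/2) for X, Y ∈ ℙ_d. Then Δ_f(X,Y) ≥ 0, Δ_f(X,Y) = Δ_f(Y,X), Δ_f(X,X) = 0, and √(Δ_f(X,Z)) ≤ √(Δ_f(X,Y)) + √(Δ_f(Y,Z)) for all X, Y, Z ∈ ℙ_d. -/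
open MeasureTheory Matrix
open scoped ComplexOrder

/-- `tr g(X)` for a Hermitian matrix `X`: the sum of `g` over the eigenvalues of `X`. -/
noncomputable def traceF {d : ℕ} (g : ℝ → ℝ) (X : Matrix (Fin d) (Fin d) ℂ) : ℝ :=
  if hX : X.IsHermitian then ∑ i, g (hX.eigenvalues i) else 0

/-- The Jensen divergence of a convex `f`:
`Δ_f(X,Y) = (1/2) tr f(X) + (1/2) tr f(Y) − tr f((X+Y)/2)`. -/
noncomputable def jensenDivConvex {d : ℕ} (f : ℝ → ℝ) (X Y : Matrix (Fin d) (Fin d) ℂ) : ℝ :=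
  (1 / 2) * traceF f X + (1 / 2) * traceF f Y - traceF f ((1 / 2 : ℝ) • (X + Y))

section SqrtTriangle

lemma le_of_sqrt_le_add {p q r : ℝ} (hp : 0 ≤ p) (hq : 0 ≤ q) (hr : 0 ≤ r)
    (h : √r ≤ √p + √q) {ε : ℝ} (hε : 0 < ε) : r ≤ (1 + ε) * p + (1 + ε⁻¹) * q := by
  have h1 : r ≤ (√p + √q) ^ 2 := by
    rw [← Real.sq_sqrt hr]
    gcongr
  have h2 : (1 + ε) * p + (1 + ε⁻¹) * q - (√p + √q) ^ 2 = ε⁻¹ * (ε * √p - √q) ^ 2 := by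
    nth_rewrite 1 [← Real.sq_sqrt hp]
    nth_rewrite 1 [← Real.sq_sqrt hq]
    field_simp
    ring
  have h3 : 0 ≤ ε⁻¹ * (ε * √p - √q) ^ 2 := by positivity
  linarith

lemma sqrt_le_add_of_forall {p q r : ℝ} (hp : 0 ≤ p) (hq : 0 ≤ q)
    (h : ∀ ε > 0, r ≤ (1 + ε) * p + (1 + ε⁻¹) * q) : √r ≤ √p + √q := by
  refine le_of_forall_pos_le_add fun δ hδ => ?_
  have hP : 0 < √p + δ / 2 := by positivity
  have hQ : 0 < √q + δ / 2 := by positivity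
  have key := h ((√q + δ / 2) / (√p + δ / 2)) (by positivity)
  have hp' : p ≤ (√p + δ / 2) ^ 2 := by
    nth_rewrite 1 [← Real.sq_sqrt hp]
    gcongr
    linarith
  have hq' : q ≤ (√q + δ / 2) ^ 2 := by
    nth_rewrite 1 [← Real.sq_sqrt hq]
    gcongr
    linarith
  refine Real.sqrt_le_iff.2 ⟨by positivity, key.trans ?_⟩
  calc _ ≤ (1 + (√q + δ / 2) / (√p + δ / 2)) * (√p + δ / 2) ^ 2
        + (1 + ((√q + δ / 2) / (√p + δ / 2))⁻¹) * (√q + δ / 2) ^ 2 := by gcongr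
    _ = (√p + √q + δ) ^ 2 := by field_simp; ring

lemma sqrt_sum_le_add {ι : Type*} (s : Finset ι) {p q r : ι → ℝ} (hp : ∀ i, 0 ≤ p i)
    (hq : ∀ i, 0 ≤ q i) (hr : ∀ i, 0 ≤ r i) (h : ∀ i, √(r i) ≤ √(p i) + √(q i)) :
    √(∑ i ∈ s, r i) ≤ √(∑ i ∈ s, p i) + √(∑ i ∈ s, q i) := by
  refine sqrt_le_add_of_forall (Finset.sum_nonneg fun i _ => hp i)
    (Finset.sum_nonneg fun i _ => hq i) fun ε hε => ?_
  rw [Finset.mul_sum, Finset.mul_sum, ← Finset.sum_add_distrib]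
  exact Finset.sum_le_sum fun i _ => le_of_sqrt_le_add (hp i) (hq i) (hr i) (h i) hε

end SqrtTriangle

section LogCosh

lemma mul_tanh_le_two_mul_log_cosh {u : ℝ} (hu : 0 ≤ u) :
    u * (Real.sinh u / Real.cosh u) ≤ 2 * Real.log (Real.cosh u) := by
  have hd : ∀ x, HasDerivAt
      (fun x => 2 * Real.log (Real.cosh x) - x * (Real.sinh x / Real.cosh x))
      (2 * (Real.sinh x / Real.cosh x) - (1 * (Real.sinh x / Real.cosh x) +
        x * ((Real.cosh x * Real.cosh x - Real.sinh x * Real.sinh x) / Real.cosh x ^ 2))) x :=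
    fun x => (((Real.hasDerivAt_cosh x).log (Real.cosh_pos x).ne').const_mul 2).sub
      ((hasDerivAt_id x).mul ((Real.hasDerivAt_sinh x).div (Real.hasDerivAt_cosh x)
        (Real.cosh_pos x).ne'))
  have hmono := monotoneOn_of_deriv_nonneg (convex_Ici (0 : ℝ))
    (f := fun x => 2 * Real.log (Real.cosh x) - x * (Real.sinh x / Real.cosh x))
    (fun x _ => (hd x).continuousAt.continuousWithinAt)
    (fun x _ => (hd x).differentiableAt.differentiableWithinAt) (fun x hx => by
      rw [interior_Ici] at hx
      rw [(hd x).deriv]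
      have hc := Real.one_le_cosh x
      have hs : x ≤ Real.sinh x := Real.self_le_sinh_iff.2 (le_of_lt hx)
      have hx0 : 0 < x := hx
      have e : 2 * (Real.sinh x / Real.cosh x) - (1 * (Real.sinh x / Real.cosh x) +
        x * ((Real.cosh x * Real.cosh x - Real.sinh x * Real.sinh x) / Real.cosh x ^ 2))
        = (Real.sinh x * Real.cosh x - x) / Real.cosh x ^ 2 := by
        have : Real.cosh x * Real.cosh x - Real.sinh x * Real.sinh x = 1 := by
          nlinarith [Real.cosh_sq x]
        rw [this]
        have := (Real.cosh_pos x).ne'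
        field_simp
        ring
      rw [e]
      apply div_nonneg _ (by positivity)
      nlinarith)
  have := hmono (Set.mem_Ici.2 le_rfl) (Set.mem_Ici.2 hu) hu
  simp at this
  linarith

lemma antitoneOn_log_cosh_div_sq :
    AntitoneOn (fun u => Real.log (Real.cosh u) / u ^ 2) (Set.Ioi 0) := by
  have hd : ∀ x : ℝ, 0 < x → HasDerivAt (fun u => Real.log (Real.cosh u) / u ^ 2)
      ((Real.sinh x / Real.cosh x * x ^ 2 - Real.log (Real.cosh x) * (2 * x)) / (x ^ 2) ^ 2) x :=
    fun x hx => by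
      have h := ((Real.hasDerivAt_cosh x).log (Real.cosh_pos x).ne').div
        (hasDerivAt_pow 2 x) (by positivity)
      norm_num at h
      exact h
  refine antitoneOn_of_deriv_nonpos (convex_Ioi 0)
    (fun x hx => (hd x hx).continuousAt.continuousWithinAt) ?_ ?_
  · rw [interior_Ioi]
    exact fun x hx => (hd x hx).differentiableAt.differentiableWithinAt
  · rw [interior_Ioi]
    intro x hx
    have hx0 : 0 < x := hx
    rw [(hd x hx).deriv]
    refine div_nonpos_of_nonpos_of_nonneg ?_ (by positivity)
    nlinarith [mul_tanh_le_two_mul_log_cosh hx0.le]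

lemma log_cosh_nonneg (u : ℝ) : 0 ≤ Real.log (Real.cosh u) :=
  Real.log_nonneg (Real.one_le_cosh u)

lemma sqrt_log_cosh_add_le_of_nonneg {u v : ℝ} (hu : 0 ≤ u) (hv : 0 ≤ v) :
    √(Real.log (Real.cosh (u + v))) ≤
      √(Real.log (Real.cosh u)) + √(Real.log (Real.cosh v)) := by
  rcases hu.eq_or_lt with rfl | hu
  · simp
  rcases hv.eq_or_lt with rfl | hv
  · simp
  have hw : 0 < u + v := by positivity
  have key : ∀ x, 0 < x → x ≤ u + v →
      x * √(Real.log (Real.cosh (u + v)) / (u + v) ^ 2) ≤ √(Real.log (Real.cosh x)) := by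
    intro x hx hxw
    have h := antitoneOn_log_cosh_div_sq (Set.mem_Ioi.2 hx) (Set.mem_Ioi.2 hw) hxw
    calc _ ≤ x * √(Real.log (Real.cosh x) / x ^ 2) := by gcongr
      _ = _ := by
        rw [Real.sqrt_div (log_cosh_nonneg x), Real.sqrt_sq hx.le]
        field_simp
  have e : √(Real.log (Real.cosh (u + v))) =
      (u + v) * √(Real.log (Real.cosh (u + v)) / (u + v) ^ 2) := by
    rw [Real.sqrt_div (log_cosh_nonneg _), Real.sqrt_sq hw.le]
    field_simp
  rw [e, add_mul]
  exact add_le_add (key u hu (by linarith)) (key v hv (by linarith))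

lemma sqrt_log_cosh_add_le (u v : ℝ) :
    √(Real.log (Real.cosh (u + v))) ≤
      √(Real.log (Real.cosh u)) + √(Real.log (Real.cosh v)) := by
  have h := sqrt_log_cosh_add_le_of_nonneg (abs_nonneg u) (abs_nonneg v)
  rw [Real.cosh_abs, Real.cosh_abs] at h
  refine le_trans (Real.sqrt_le_sqrt (Real.log_le_log (Real.cosh_pos _) ?_)) h
  rw [Real.cosh_le_cosh, abs_of_nonneg (by positivity : 0 ≤ |u| + |v|)]
  exact abs_add_le u v

/-- The one-dimensional S-divergence. -/
noncomputable def scalarSDiv (x y : ℝ) : ℝ :=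
  Real.log ((x + y) / 2) - (1 / 2) * Real.log x - (1 / 2) * Real.log y

lemma scalarSDiv_eq_log_cosh {x y : ℝ} (hx : 0 < x) (hy : 0 < y) :
    scalarSDiv x y = Real.log (Real.cosh ((Real.log x - Real.log y) / 2)) := by
  have e : (x + y) / 2 = Real.exp ((Real.log x + Real.log y) / 2) *
      Real.cosh ((Real.log x - Real.log y) / 2) := by
    rw [Real.cosh_eq, mul_div_assoc', mul_add, ← Real.exp_add, ← Real.exp_add]
    ring_nf
    rw [Real.exp_log hx, Real.exp_log hy]
  rw [scalarSDiv, e, Real.log_mul (Real.exp_pos _).ne' (Real.cosh_pos _).ne', Real.log_exp]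
  ring

lemma scalarSDiv_nonneg {x y : ℝ} (hx : 0 < x) (hy : 0 < y) : 0 ≤ scalarSDiv x y := by
  rw [scalarSDiv_eq_log_cosh hx hy]
  exact log_cosh_nonneg _

lemma sqrt_scalarSDiv_le_add {x y z : ℝ} (hx : 0 < x) (hy : 0 < y) (hz : 0 < z) :
    √(scalarSDiv x z) ≤ √(scalarSDiv x y) + √(scalarSDiv y z) := by
  rw [scalarSDiv_eq_log_cosh hx hz, scalarSDiv_eq_log_cosh hx hy, scalarSDiv_eq_log_cosh hy hz]
  convert sqrt_log_cosh_add_le ((Real.log x - Real.log y) / 2) ((Real.log y - Real.log z) / 2)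
    using 4
  ring

end LogCosh

section Pairing

variable {n : Type*} [Fintype n] [DecidableEq n]

lemma doublyStochastic_mulVec_pos {P : Matrix n n ℝ} (hP : P ∈ doublyStochastic ℝ n)
    {a : n → ℝ} (ha : ∀ i, 0 < a i) (i : n) : 0 < (P *ᵥ a) i := by
  have hnn : ∀ j ∈ Finset.univ, 0 ≤ P i j * a j := fun j _ =>
    mul_nonneg (nonneg_of_mem_doublyStochastic hP) (ha j).le
  refine lt_of_le_of_ne (Finset.sum_nonneg hnn) fun h => ?_
  have h0 := (Finset.sum_eq_zero_iff_of_nonneg hnn).1 h.symm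
  have h1 := sum_row_of_mem_doublyStochastic hP i
  rw [Finset.sum_eq_zero fun j hj => (mul_eq_zero.1 (h0 j hj)).resolve_right (ha j).ne'] at h1
  exact zero_ne_one h1

lemma exists_perm_sum_log_le {P Q : Matrix n n ℝ} (hP : P ∈ doublyStochastic ℝ n)
    (hQ : Q ∈ doublyStochastic ℝ n) {a b : n → ℝ} (ha : ∀ i, 0 < a i) (hb : ∀ i, 0 < b i) :
    ∃ σ τ : Equiv.Perm n, ∑ i, Real.log ((a (σ i) + b (τ i)) / 2) ≤
      ∑ i, Real.log (((P *ᵥ a) i + (Q *ᵥ b) i) / 2) := by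
  let L : n → (Matrix n n ℝ × Matrix n n ℝ) →ₗ[ℝ] ℝ := fun i =>
    { toFun := fun M => ((M.1 *ᵥ a) i + (M.2 *ᵥ b) i) / 2
      map_add' := fun M N => by simp [add_mulVec]; ring
      map_smul' := fun c M => by simp [smul_mulVec]; ring }
  have hconv : Convex ℝ ((doublyStochastic ℝ n : Set (Matrix n n ℝ)) ×ˢ
      (doublyStochastic ℝ n : Set (Matrix n n ℝ))) :=
    convex_doublyStochastic.prod convex_doublyStochastic
  have hpos : ∀ i, ∀ M ∈ (doublyStochastic ℝ n : Set (Matrix n n ℝ)) ×ˢ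
      (doublyStochastic ℝ n : Set (Matrix n n ℝ)), 0 < L i M := fun i M hM => by
    have h1 := doublyStochastic_mulVec_pos hM.1 ha i
    have h2 := doublyStochastic_mulVec_pos hM.2 hb i
    change 0 < ((M.1 *ᵥ a) i + (M.2 *ᵥ b) i) / 2
    positivity
  have hconc : ConcaveOn ℝ ((doublyStochastic ℝ n : Set (Matrix n n ℝ)) ×ˢ
      (doublyStochastic ℝ n : Set (Matrix n n ℝ))) fun M => ∑ i, Real.log (L i M) := by
    refine ⟨hconv, fun M hM N hN s t hs ht hst => ?_⟩
    simp only [Finset.smul_sum, ← Finset.sum_add_distrib]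
    refine Finset.sum_le_sum fun i _ => ?_
    rw [map_add, map_smul, map_smul]
    exact strictConcaveOn_log_Ioi.concaveOn.2 (hpos i M hM) (hpos i N hN) hs ht hst
  have hmem : (P, Q) ∈ convexHull ℝ ({σ.permMatrix ℝ | σ : Equiv.Perm n} ×ˢ
      {σ.permMatrix ℝ | σ : Equiv.Perm n}) := by
    rw [convexHull_prod, ← doublyStochastic_eq_convexHull_permMatrix]
    exact ⟨hP, hQ⟩
  obtain ⟨⟨_, _⟩, ⟨⟨σ, rfl⟩, ⟨τ, rfl⟩⟩, h⟩ := hconc.exists_le_of_mem_convexHull (by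
    rintro ⟨_, _⟩ ⟨⟨σ, rfl⟩, ⟨τ, rfl⟩⟩
    exact ⟨permMatrix_mem_doublyStochastic, permMatrix_mem_doublyStochastic⟩) hmem
  refine ⟨σ, τ, ?_⟩
  simpa [L, permMatrix_mulVec] using h

lemma normSq_mem_doublyStochastic {U : Matrix n n ℂ} (hU : U ∈ unitaryGroup n ℂ) :
    (of fun i j => Complex.normSq (U i j)) ∈ doublyStochastic ℝ n := by
  refine mem_doublyStochastic_iff_sum.2 ⟨fun i j => Complex.normSq_nonneg _, fun i => ?_,
    fun j => ?_⟩
  · have h := congrFun (congrFun (mem_unitaryGroup_iff.1 hU) i) i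
    simp only [mul_apply, star_apply, one_apply_eq, RCLike.star_def, Complex.mul_conj] at h
    exact_mod_cast h
  · have h := congrFun (congrFun (mem_unitaryGroup_iff'.1 hU) j) j
    simp only [mul_apply, star_apply, one_apply_eq, RCLike.star_def, mul_comm (starRingEnd ℂ _),
      Complex.mul_conj] at h
    exact_mod_cast h

lemma conj_diagonal_apply_self (U : Matrix n n ℂ) (a : n → ℝ) (i : n) :
    (U * diagonal (fun j => (a j : ℂ)) * star U) i i =
      (((of fun i j => Complex.normSq (U i j)) *ᵥ a) i : ℝ) := by
  rw [mul_apply]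
  simp only [mul_diagonal, star_apply, RCLike.star_def, mulVec, dotProduct, of_apply]
  push_cast
  refine Finset.sum_congr rfl fun j _ => ?_
  rw [← Complex.mul_conj]
  ring

lemma Matrix.IsHermitian.eq_unitary_conj {A : Matrix n n ℂ} (hA : A.IsHermitian) :
    A = (hA.eigenvectorUnitary : Matrix n n ℂ) * diagonal (fun j => (hA.eigenvalues j : ℂ)) *
      star (hA.eigenvectorUnitary : Matrix n n ℂ) := by
  conv_lhs => rw [hA.spectral_theorem, Unitary.conjStarAlgAut_apply]
  rfl

lemma Matrix.IsHermitian.exists_doublyStochastic_conj_diag {A : Matrix n n ℂ}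
    (hA : A.IsHermitian) {W : Matrix n n ℂ} (hW : W ∈ unitaryGroup n ℂ) :
    ∃ P ∈ doublyStochastic ℝ n, ∀ i, (star W * A * W) i i = ((P *ᵥ hA.eigenvalues) i : ℝ) := by
  refine ⟨_, normSq_mem_doublyStochastic
    (mul_mem (Unitary.star_mem hW) hA.eigenvectorUnitary.2), fun i => ?_⟩
  rw [← conj_diagonal_apply_self]
  conv_lhs => rw [hA.eq_unitary_conj]
  simp only [star_mul, star_star, Matrix.mul_assoc]

end Pairing

lemma Matrix.PosDef.half_add {n : Type*} {X Y : Matrix n n ℂ} (hX : X.PosDef) (hY : Y.PosDef) :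
    ((1 / 2 : ℝ) • (X + Y)).PosDef :=
  (hX.add hY).smul (by norm_num : (0 : ℝ) < 1 / 2)

section SDiv

variable {n : Type*} [Fintype n] [DecidableEq n]

/-- The logarithm of the (real part of the) determinant. -/
noncomputable def logDet (A : Matrix n n ℂ) : ℝ := Real.log A.det.re

/-- The S-divergence `log det ((X + Y) / 2) - (1/2) log det (X Y)`. -/
noncomputable def sDiv (X Y : Matrix n n ℂ) : ℝ :=
  logDet ((1 / 2 : ℝ) • (X + Y)) - (1 / 2) * logDet X - (1 / 2) * logDet Y

lemma Matrix.IsHermitian.det_one_add_smul {A : Matrix n n ℂ} (hA : A.IsHermitian) (t : ℝ) :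
    (1 + t • A).det = ((∏ i, (1 + t * hA.eigenvalues i) : ℝ) : ℂ) := by
  set U := hA.eigenvectorUnitary
  have hU : (U : Matrix n n ℂ) * star (U : Matrix n n ℂ) = 1 := mem_unitaryGroup_iff.1 U.2
  have e : 1 + t • A = (U : Matrix n n ℂ) *
      diagonal (fun j => ((1 + t * hA.eigenvalues j : ℝ) : ℂ)) * star (U : Matrix n n ℂ) := by
    have hd : diagonal (fun j => ((1 + t * hA.eigenvalues j : ℝ) : ℂ)) =
        1 + t • diagonal (fun j => (hA.eigenvalues j : ℂ)) := by
      ext i j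
      by_cases h : i = j <;> simp [h]
    conv_lhs => rw [hA.eq_unitary_conj]
    rw [hd, Matrix.mul_add, Matrix.add_mul, Matrix.mul_one, hU, Matrix.mul_smul, Matrix.smul_mul]
  rw [e, det_mul_right_comm, hU, Matrix.one_mul, det_diagonal]
  push_cast
  rfl

lemma Matrix.IsHermitian.logDet_one_add_smul {A : Matrix n n ℂ} (hA : A.IsHermitian) {t : ℝ}
    (h : ∀ i, 1 + t * hA.eigenvalues i ≠ 0) :
    logDet (1 + t • A) = ∑ i, Real.log (1 + t * hA.eigenvalues i) := by
  rw [logDet, hA.det_one_add_smul, Complex.ofReal_re, Real.log_prod fun i _ => h i]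

lemma Matrix.PosDef.logDet_eq_sum {A : Matrix n n ℂ} (hA : A.PosDef) :
    logDet A = ∑ i, Real.log (hA.1.eigenvalues i) := by
  rw [logDet, hA.1.det_eq_prod_eigenvalues]
  have : ∏ i, (hA.1.eigenvalues i : ℂ) = ((∏ i, hA.1.eigenvalues i : ℝ) : ℂ) := by
    push_cast
    rfl
  erw [this]
  rw [Complex.ofReal_re, Real.log_prod fun i _ => (hA.eigenvalues_pos i).ne']

lemma Matrix.PosDef.exists_perm_sum_scalarSDiv_le {X Y : Matrix n n ℂ} (hX : X.PosDef)
    (hY : Y.PosDef) : ∃ σ τ : Equiv.Perm n,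
      ∑ i, scalarSDiv (hX.1.eigenvalues (σ i)) (hY.1.eigenvalues (τ i)) ≤ sDiv X Y := by
  have hM := hX.half_add hY
  set W := hM.1.eigenvectorUnitary
  obtain ⟨P, hP, hPe⟩ := hX.1.exists_doublyStochastic_conj_diag W.2
  obtain ⟨Q, hQ, hQe⟩ := hY.1.exists_doublyStochastic_conj_diag W.2
  have hWW : star (W : Matrix n n ℂ) * W = 1 := mem_unitaryGroup_iff'.1 W.2
  have hm : ∀ i, hM.1.eigenvalues i =
      ((P *ᵥ hX.1.eigenvalues) i + (Q *ᵥ hY.1.eigenvalues) i) / 2 := fun i => by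
    have h1 : star (W : Matrix n n ℂ) * ((1 / 2 : ℝ) • (X + Y)) * W =
        diagonal (fun j => (hM.1.eigenvalues j : ℂ)) := by
      conv_lhs => rw [hM.1.eq_unitary_conj]
      change star (W : Matrix n n ℂ) * (W * _ * star (W : Matrix n n ℂ)) * W = _
      simp only [Matrix.mul_assoc]
      rw [hWW, Matrix.mul_one, ← Matrix.mul_assoc, hWW, Matrix.one_mul]
    have h2 := congrFun (congrFun h1 i) i
    rw [Matrix.mul_smul, Matrix.smul_mul, Matrix.mul_add, Matrix.add_mul, smul_apply, add_apply,
      hPe, hQe, diagonal_apply_eq, Complex.real_smul] at h2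
    have h3 : (1 / 2 : ℝ) * ((P *ᵥ hX.1.eigenvalues) i + (Q *ᵥ hY.1.eigenvalues) i) =
      hM.1.eigenvalues i := by exact_mod_cast h2
    linarith
  obtain ⟨σ, τ, h⟩ := exists_perm_sum_log_le hP hQ hX.eigenvalues_pos hY.eigenvalues_pos
  refine ⟨σ, τ, ?_⟩
  rw [sDiv, hM.logDet_eq_sum, hX.logDet_eq_sum, hY.logDet_eq_sum]
  simp only [hm, scalarSDiv, Finset.sum_sub_distrib, ← Finset.mul_sum]
  rw [Equiv.sum_comp σ fun i => Real.log (hX.1.eigenvalues i),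
    Equiv.sum_comp τ fun i => Real.log (hY.1.eigenvalues i)]
  linarith

lemma Matrix.PosDef.sDiv_nonneg {X Y : Matrix n n ℂ} (hX : X.PosDef) (hY : Y.PosDef) :
    0 ≤ sDiv X Y := by
  obtain ⟨σ, τ, h⟩ := hX.exists_perm_sum_scalarSDiv_le hY
  exact (Finset.sum_nonneg fun i _ =>
    scalarSDiv_nonneg (hX.eigenvalues_pos _) (hY.eigenvalues_pos _)).trans h

lemma Matrix.PosDef.sDiv_one_left {X : Matrix n n ℂ} (hX : X.PosDef) :
    sDiv 1 X = ∑ i, scalarSDiv 1 (hX.1.eigenvalues i) := by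
  have hdet : ((1 / 2 : ℝ) • (1 + X)).det =
      ((∏ i, (1 + hX.1.eigenvalues i) / 2 : ℝ) : ℂ) := by
    have := hX.1.det_one_add_smul 1
    rw [one_smul] at this
    rw [← Complex.coe_smul, det_smul, this]
    simp [div_eq_inv_mul, Finset.prod_mul_distrib]
  have hpos : ∀ i, (1 + hX.1.eigenvalues i) / 2 ≠ 0 := fun i => by
    have := hX.eigenvalues_pos i
    positivity
  rw [sDiv, hX.logDet_eq_sum, logDet, hdet, Complex.ofReal_re, Real.log_prod fun i _ => hpos i]
  simp [logDet, scalarSDiv, Finset.sum_sub_distrib, Finset.mul_sum]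

lemma logDet_conj {C X : Matrix n n ℂ} (hC : C.det ≠ 0) (hX : X.PosDef) :
    logDet (Cᴴ * X * C) = Real.log (Complex.normSq C.det) + logDet X := by
  have hre : 0 < X.det.re := (Complex.pos_iff.1 hX.det_pos).1
  have e : (Cᴴ * X * C).det = (Complex.normSq C.det : ℂ) * X.det := by
    rw [det_mul, det_mul, det_conjTranspose, ← Complex.mul_conj, RCLike.star_def]
    ring
  rw [logDet, e, Complex.re_ofReal_mul,
    Real.log_mul (Complex.normSq_pos.2 hC).ne' hre.ne', logDet]

lemma sDiv_conj {C X Y : Matrix n n ℂ} (hC : C.det ≠ 0) (hX : X.PosDef) (hY : Y.PosDef) :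
    sDiv (Cᴴ * X * C) (Cᴴ * Y * C) = sDiv X Y := by
  have e : (1 / 2 : ℝ) • (Cᴴ * X * C + Cᴴ * Y * C) = Cᴴ * ((1 / 2 : ℝ) • (X + Y)) * C := by
    rw [Matrix.mul_smul, Matrix.smul_mul, Matrix.mul_add, Matrix.add_mul]
  rw [sDiv, e, logDet_conj hC hX, logDet_conj hC hY, logDet_conj hC (hX.half_add hY), sDiv]
  ring

lemma Matrix.PosDef.sqrt_sDiv_one_le_add {Y Z : Matrix n n ℂ} (hY : Y.PosDef) (hZ : Z.PosDef) :
    √(sDiv 1 Z) ≤ √(sDiv 1 Y) + √(sDiv Y Z) := by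
  obtain ⟨σ, τ, h⟩ := hY.exists_perm_sum_scalarSDiv_le hZ
  have hy := hY.eigenvalues_pos
  have hz := hZ.eigenvalues_pos
  rw [hY.sDiv_one_left, hZ.sDiv_one_left,
    ← Equiv.sum_comp σ fun i => scalarSDiv 1 (hY.1.eigenvalues i),
    ← Equiv.sum_comp τ fun i => scalarSDiv 1 (hZ.1.eigenvalues i)]
  refine (sqrt_sum_le_add _ (fun i => scalarSDiv_nonneg one_pos (hy (σ i)))
    (fun i => scalarSDiv_nonneg (hy (σ i)) (hz (τ i)))
    (fun i => scalarSDiv_nonneg one_pos (hz (τ i)))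
    fun i => sqrt_scalarSDiv_le_add one_pos (hy (σ i)) (hz (τ i))).trans ?_
  gcongr

open scoped MatrixOrder in
lemma Matrix.PosDef.exists_eq_conjTranspose_mul_self {X : Matrix n n ℂ} (hX : X.PosDef) :
    ∃ C : Matrix n n ℂ, X = Cᴴ * C :=
  CStarAlgebra.nonneg_iff_eq_star_mul_self.mp hX.posSemidef.nonneg

lemma Matrix.PosDef.sqrt_sDiv_le_add {X Y Z : Matrix n n ℂ} (hX : X.PosDef) (hY : Y.PosDef)
    (hZ : Z.PosDef) : √(sDiv X Z) ≤ √(sDiv X Y) + √(sDiv Y Z) := by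
  obtain ⟨C, hC⟩ := hX.exists_eq_conjTranspose_mul_self
  have hdet : C.det ≠ 0 := fun h => hX.det_pos.ne' (by rw [hC, det_mul, h, mul_zero])
  have hu : IsUnit C.det := isUnit_iff_ne_zero.2 hdet
  have hD : IsUnit C⁻¹ := (isUnit_nonsing_inv_iff).2 ((isUnit_iff_isUnit_det C).2 hu)
  have hCC : Cᴴ * (C⁻¹)ᴴ = 1 := by
    rw [← conjTranspose_mul, nonsing_inv_mul _ hu, conjTranspose_one]
  have key : ∀ W : Matrix n n ℂ, W.PosDef →
      ∃ W' : Matrix n n ℂ, W'.PosDef ∧ W = Cᴴ * W' * C := fun W hW =>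
    ⟨(C⁻¹)ᴴ * W * C⁻¹, hW.conjTranspose_mul_mul_same (mulVec_injective_of_isUnit hD), by
      calc W = 1 * W * 1 := by simp
        _ = (Cᴴ * (C⁻¹)ᴴ) * W * (C⁻¹ * C) := by rw [hCC, nonsing_inv_mul _ hu]
        _ = _ := by simp only [Matrix.mul_assoc]⟩
  obtain ⟨Y', hY', rfl⟩ := key Y hY
  obtain ⟨Z', hZ', rfl⟩ := key Z hZ
  have hX1 : X = Cᴴ * 1 * C := by rw [Matrix.mul_one, hC]
  rw [hX1, sDiv_conj hdet .one hY', sDiv_conj hdet .one hZ', sDiv_conj hdet hY' hZ']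
  exact hY'.sqrt_sDiv_one_le_add hZ'

end SDiv

section TraceFormula

variable {d : ℕ}

lemma Matrix.PosDef.one_add_smul {X : Matrix (Fin d) (Fin d) ℂ} (hX : X.PosDef) {t : ℝ}
    (ht : 0 < t) : (1 + t • X).PosDef :=
  Matrix.PosDef.one.add (hX.smul ht)

/-- The trace of `t x - log (1 + t x)` evaluated at a matrix. -/
noncomputable def traceKernel (X : Matrix (Fin d) (Fin d) ℂ) (t : ℝ) : ℝ :=
  t * X.trace.re - logDet (1 + t • X)

lemma Matrix.IsHermitian.trace_re_eq {X : Matrix (Fin d) (Fin d) ℂ} (hX : X.IsHermitian) :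
    X.trace.re = ∑ i, hX.eigenvalues i := by
  rw [hX.trace_eq_sum_eigenvalues, Complex.re_sum]
  rfl

lemma Matrix.PosDef.traceKernel_eq_sum {X : Matrix (Fin d) (Fin d) ℂ} (hX : X.PosDef) {t : ℝ}
    (ht : 0 < t) : traceKernel X t =
      ∑ i, (t * hX.1.eigenvalues i - Real.log (1 + t * hX.1.eigenvalues i)) := by
  rw [traceKernel, hX.1.trace_re_eq, hX.1.logDet_one_add_smul, Finset.sum_sub_distrib,
    Finset.mul_sum]
  intro i
  have := hX.eigenvalues_pos i
  positivity

lemma Matrix.PosDef.integrableOn_traceKernel {X : Matrix (Fin d) (Fin d) ℂ} (hX : X.PosDef)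
    {μ : Measure ℝ} (hint : ∀ x > (0:ℝ),
      IntegrableOn (fun t => t * x - Real.log (1 + t * x)) (Set.Ioi 0) μ) :
    IntegrableOn (traceKernel X) (Set.Ioi 0) μ :=
  IntegrableOn.congr_fun
    (integrable_finsetSum Finset.univ fun i _ => hint _ (hX.eigenvalues_pos i))
    (fun _ ht => (hX.traceKernel_eq_sum ht).symm) measurableSet_Ioi

lemma Matrix.PosDef.traceF_eq {X : Matrix (Fin d) (Fin d) ℂ} (hX : X.PosDef) {a b c : ℝ}
    {μ : Measure ℝ} (hint : ∀ x > (0:ℝ),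
      IntegrableOn (fun t => t * x - Real.log (1 + t * x)) (Set.Ioi 0) μ) {f : ℝ → ℝ}
    (hf : ∀ x > (0:ℝ), f x = a + b * x - c * Real.log x
        + ∫ t in Set.Ioi (0:ℝ), (t * x - Real.log (1 + t * x)) ∂μ) :
    traceF f X = d * a + b * X.trace.re - c * logDet X
      + ∫ t in Set.Ioi (0:ℝ), traceKernel X t ∂μ := by
  rw [traceF, dif_pos hX.1, setIntegral_congr_fun measurableSet_Ioi
      fun t ht => hX.traceKernel_eq_sum ht,
    integral_finsetSum _ fun i _ => hint _ (hX.eigenvalues_pos i),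
    Finset.sum_congr rfl fun i _ => hf _ (hX.eigenvalues_pos i), hX.1.trace_re_eq,
    hX.logDet_eq_sum]
  simp [Finset.sum_add_distrib, Finset.sum_sub_distrib, Finset.mul_sum]

lemma traceKernel_jensen (X Y : Matrix (Fin d) (Fin d) ℂ) (t : ℝ) :
    (1 / 2) * traceKernel X t + (1 / 2) * traceKernel Y t
      - traceKernel ((1 / 2 : ℝ) • (X + Y)) t = sDiv (1 + t • X) (1 + t • Y) := by
  have e : (1 / 2 : ℝ) • ((1 + t • X) + (1 + t • Y)) = 1 + t • ((1 / 2 : ℝ) • (X + Y)) := by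
    module
  have h : ((1 / 2 : ℝ) • (X + Y)).trace.re = (1 / 2) * (X.trace.re + Y.trace.re) := by
    rw [trace_smul, Complex.smul_re, trace_add, Complex.add_re, smul_eq_mul]
  rw [sDiv, e, traceKernel, traceKernel, traceKernel, h]
  ring

lemma integrableOn_sDiv_one_add_smul {X Y : Matrix (Fin d) (Fin d) ℂ} (hX : X.PosDef)
    (hY : Y.PosDef) {μ : Measure ℝ} (hint : ∀ x > (0:ℝ),
      IntegrableOn (fun t => t * x - Real.log (1 + t * x)) (Set.Ioi 0) μ) :
    IntegrableOn (fun t : ℝ => sDiv (1 + t • X) (1 + t • Y)) (Set.Ioi 0) μ := by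
  simp only [← traceKernel_jensen]
  exact (((hX.integrableOn_traceKernel hint).const_mul _).add
    ((hY.integrableOn_traceKernel hint).const_mul _)).sub
    ((hX.half_add hY).integrableOn_traceKernel hint)

lemma jensenDivConvex_eq {X Y : Matrix (Fin d) (Fin d) ℂ} (hX : X.PosDef) (hY : Y.PosDef)
    {a b c : ℝ} {μ : Measure ℝ} (hint : ∀ x > (0:ℝ),
      IntegrableOn (fun t => t * x - Real.log (1 + t * x)) (Set.Ioi 0) μ) {f : ℝ → ℝ}
    (hf : ∀ x > (0:ℝ), f x = a + b * x - c * Real.log x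
        + ∫ t in Set.Ioi (0:ℝ), (t * x - Real.log (1 + t * x)) ∂μ) :
    jensenDivConvex f X Y =
      c * sDiv X Y + ∫ t in Set.Ioi (0:ℝ), sDiv (1 + t • X) (1 + t • Y) ∂μ := by
  have iX := (hX.integrableOn_traceKernel hint).const_mul (1 / 2)
  have iY := (hY.integrableOn_traceKernel hint).const_mul (1 / 2)
  have h : ((1 / 2 : ℝ) • (X + Y)).trace.re = (1 / 2) * (X.trace.re + Y.trace.re) := by
    rw [trace_smul, Complex.smul_re, trace_add, Complex.add_re, smul_eq_mul]
  have iXY : Integrable (fun t => (1 / 2) * traceKernel X t + (1 / 2) * traceKernel Y t)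
    (μ.restrict (Set.Ioi 0)) := iX.add iY
  simp only [← traceKernel_jensen]
  rw [integral_sub iXY ((hX.half_add hY).integrableOn_traceKernel hint),
    integral_add iX iY, integral_const_mul, integral_const_mul, jensenDivConvex,
    hX.traceF_eq hint hf, hY.traceF_eq hint hf, (hX.half_add hY).traceF_eq hint hf, h, sDiv]
  ring

end TraceFormula

/-- **Theorem 2**: if `f(x) = a + b·x − c·log x + ∫₀^∞ (t·x − log(1+t·x)) dμ(t)` with `c ≥ 0`,
then the square root of the Jensen divergence `Δ_f` is a distance on `ℙ_d`. -/
theorem jensenDivConvex_sqrt_metric {d : ℕ} (a b c : ℝ) (hc : 0 ≤ c) (μ : Measure ℝ)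
    (hint : ∀ x > (0:ℝ),
      IntegrableOn (fun t => t * x - Real.log (1 + t * x)) (Set.Ioi 0) μ)
    (f : ℝ → ℝ)
    (hf : ∀ x > (0:ℝ), f x = a + b * x - c * Real.log x
        + ∫ t in Set.Ioi (0:ℝ), (t * x - Real.log (1 + t * x)) ∂μ) :
    ∀ X Y Z : Matrix (Fin d) (Fin d) ℂ, X.PosDef → Y.PosDef → Z.PosDef →
      0 ≤ jensenDivConvex f X Y ∧
      jensenDivConvex f X Y = jensenDivConvex f Y X ∧
      jensenDivConvex f X X = 0 ∧
      Real.sqrt (jensenDivConvex f X Z) ≤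
        Real.sqrt (jensenDivConvex f X Y) + Real.sqrt (jensenDivConvex f Y Z) := by
  intro X Y Z hX hY hZ
  have hnonneg : ∀ {A B : Matrix (Fin d) (Fin d) ℂ}, A.PosDef → B.PosDef →
      0 ≤ jensenDivConvex f A B := fun hA hB => by
    rw [jensenDivConvex_eq hA hB hint hf]
    exact add_nonneg (mul_nonneg hc (hA.sDiv_nonneg hB)) (setIntegral_nonneg measurableSet_Ioi
      fun t ht => (hA.one_add_smul ht).sDiv_nonneg (hB.one_add_smul ht))
  refine ⟨hnonneg hX hY, ?_, ?_, ?_⟩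
  · rw [jensenDivConvex, jensenDivConvex, add_comm Y X]
    ring
  · have e : (1 / 2 : ℝ) • (X + X) = X := by module
    rw [jensenDivConvex, e]
    ring
  refine sqrt_le_add_of_forall (hnonneg hX hY) (hnonneg hY hZ) fun ε hε => ?_
  have step : ∀ {A B C : Matrix (Fin d) (Fin d) ℂ}, A.PosDef → B.PosDef → C.PosDef →
      sDiv A C ≤ (1 + ε) * sDiv A B + (1 + ε⁻¹) * sDiv B C := fun hA hB hC =>
    le_of_sqrt_le_add (hA.sDiv_nonneg hB) (hB.sDiv_nonneg hC) (hA.sDiv_nonneg hC)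
      (hA.sqrt_sDiv_le_add hB hC) hε
  have i1 := (integrableOn_sDiv_one_add_smul hX hY hint).const_mul (1 + ε)
  have i2 := (integrableOn_sDiv_one_add_smul hY hZ hint).const_mul (1 + ε⁻¹)
  have hI := setIntegral_mono_on (integrableOn_sDiv_one_add_smul hX hZ hint) (i1.add i2)
    measurableSet_Ioi fun t ht =>
      step (hX.one_add_smul ht) (hY.one_add_smul ht) (hZ.one_add_smul ht)
  have hI' := hI.trans_eq (integral_add i1 i2)
  rw [integral_const_mul, integral_const_mul] at hI'
  have hs := mul_le_mul_of_nonneg_left (step hX hY hZ) hc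
  rw [jensenDivConvex_eq hX hZ hint hf, jensenDivConvex_eq hX hY hint hf,
    jensenDivConvex_eq hY hZ hint hf]
  linarith
end

section
/- Fix α ∈ (0,∞)\{1} and X, Y ∈ ℙ_d, and set M := ((X^α + Y^α)/2)^{1/α}. Then for every Z ∈ ℙ_d, S_α(X,M) + S_α(Y,M) ≤ S_α(X,Z) + S_α(Y,Z); i.e., M minimizes Z ↦ S_α(X,Z) + S_α(Y,Z) over ℙ_d. -/
open Matrix
open scoped ComplexOrder

/-- The matrix power `X^r` of a Hermitian matrix `X`, defined via the spectral
decomposition (functional calculus applied to `x ↦ x^r`). -/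
noncomputable def mpow {d : ℕ} (X : Matrix (Fin d) (Fin d) ℂ) (r : ℝ) :
    Matrix (Fin d) (Fin d) ℂ :=
  if hX : X.IsHermitian then hX.cfc (fun x => x ^ r) else 0

/-- The α-Tsallis relative entropy
`S_α(X,Y) = (α·tr X + (1−α)·tr Y − tr(X^α Y^{1−α}))/(1−α)`. -/
noncomputable def tsallisRel {d : ℕ} (α : ℝ) (X Y : Matrix (Fin d) (Fin d) ℂ) : ℝ :=
  (α * X.trace.re + (1 - α) * Y.trace.re - (mpow X α * mpow Y (1 - α)).trace.re) / (1 - α)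

/-- The power mean `M = ((X^α + Y^α)/2)^{1/α}`. -/
noncomputable def powerMean {d : ℕ} (α : ℝ) (X Y : Matrix (Fin d) (Fin d) ℂ) :
    Matrix (Fin d) (Fin d) ℂ :=
  mpow ((1 / 2 : ℝ) • (mpow X α + mpow Y α)) (1 / α)

theorem rpow_mul_rpow_le_weighted_div {α a b : ℝ} (hα : 0 < α) (hα1 : α ≠ 1) (ha : 0 < a)
    (hb : 0 < b) : 0 ≤ (α * a + (1 - α) * b - a ^ α * b ^ (1 - α)) / (1 - α) := by
  have key : a ^ α * b ^ (1 - α) = b * (1 + (a / b - 1)) ^ α := by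
    rw [add_sub_cancel, Real.div_rpow ha.le hb.le, Real.rpow_sub hb, Real.rpow_one]
    ring
  have lin : α * a + (1 - α) * b = b * (1 + α * (a / b - 1)) := by
    field_simp
    ring
  have hs : -1 ≤ a / b - 1 := by linarith [div_pos ha hb]
  rw [key, lin]
  rcases lt_or_gt_of_ne hα1 with h | h
  · refine div_nonneg (sub_nonneg.2 ?_) (by linarith)
    gcongr
    exact rpow_one_add_le_one_add_mul_self hs hα.le h.le
  · refine div_nonneg_of_nonpos (sub_nonpos.2 ?_) (by linarith)
    gcongr
    exact one_add_mul_self_le_rpow_one_add hs h.le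

namespace Matrix.IsHermitian

variable {n : Type*} [Fintype n] [DecidableEq n] {A B : Matrix n n ℂ}

/-- Traces of products of functions of two Hermitian matrices are double sums over the two spectra,
with nonnegative weights that do not depend on the functions. -/
theorem exists_weights_trace_cfc_mul_cfc (hA : A.IsHermitian) (hB : B.IsHermitian) :
    ∃ w : n → n → ℝ, (∀ i j, 0 ≤ w i j) ∧ ∀ f g : ℝ → ℝ, (cfc f A * cfc g B).trace.re =
      ∑ i, ∑ j, w i j * (f (hA.eigenvalues i) * g (hB.eigenvalues j)) := by
  set U : Matrix n n ℂ := ↑hA.eigenvectorUnitary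
  set V : Matrix n n ℂ := ↑hB.eigenvectorUnitary
  refine ⟨fun i j => Complex.normSq ((star U * V) i j), fun i j => Complex.normSq_nonneg _,
    fun f g => ?_⟩
  have htr : (cfc f A * cfc g B).trace =
      (diagonal (fun i => (f (hA.eigenvalues i) : ℂ)) * (star U * V) *
        (diagonal (fun j => (g (hB.eigenvalues j) : ℂ)) * star (star U * V))).trace := by
    rw [hA.cfc_eq, hB.cfc_eq, IsHermitian.cfc, IsHermitian.cfc, Unitary.conjStarAlgAut_apply,
      Unitary.conjStarAlgAut_apply, star_mul, star_star]
    rw [Matrix.mul_assoc, Matrix.mul_assoc, Matrix.trace_mul_comm]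
    simp only [Matrix.mul_assoc]
    rfl
  rw [htr, Matrix.trace, Complex.re_sum]
  refine Finset.sum_congr rfl fun i _ => ?_
  rw [Matrix.diag_apply, Matrix.mul_apply, Complex.re_sum]
  refine Finset.sum_congr rfl fun j _ => ?_
  rw [Matrix.diagonal_mul, Matrix.diagonal_mul, Matrix.star_apply, Complex.star_def,
    mul_mul_mul_comm, Complex.mul_conj,
    ← Complex.ofReal_mul, ← Complex.ofReal_mul, Complex.ofReal_re]
  exact mul_comm _ _

end Matrix.IsHermitian

section MatrixPower

variable {d : ℕ} {X Z : Matrix (Fin d) (Fin d) ℂ}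

theorem mpow_eq_cfc (hX : X.IsHermitian) (r : ℝ) : mpow X r = cfc (fun x : ℝ => x ^ r) X := by
  rw [mpow, dif_pos hX, hX.cfc_eq]

theorem Matrix.PosDef.spectrum_real_pos (hX : X.PosDef) {x : ℝ} (hx : x ∈ spectrum ℝ X) :
    0 < x := by
  rw [hX.isHermitian.spectrum_real_eq_range_eigenvalues] at hx
  obtain ⟨i, rfl⟩ := hx
  exact hX.eigenvalues_pos i

theorem Matrix.PosDef.mpow (hX : X.PosDef) (r : ℝ) : (mpow X r).PosDef := by
  rw [_root_.mpow, dif_pos hX.isHermitian, IsHermitian.cfc, Unitary.conjStarAlgAut_apply,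
    Unitary.isUnit_coe.posDef_star_right_conjugate_iff, posDef_diagonal_iff]
  intro i
  simpa using Real.rpow_pos_of_pos (hX.eigenvalues_pos i) r

theorem mpow_one_div_mpow (hX : X.PosDef) {r : ℝ} (hr : r ≠ 0) : mpow (mpow X (1 / r)) r = X := by
  rw [mpow_eq_cfc (hX.mpow _).isHermitian, mpow_eq_cfc hX.isHermitian,
    ← cfc_comp' (fun x : ℝ => x ^ r) (fun x : ℝ => x ^ (1 / r)) X
      ((Set.Finite.image _ Matrix.finite_real_spectrum).continuousOn _)
      (Matrix.finite_real_spectrum.continuousOn _) hX.isHermitian.isSelfAdjoint]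
  conv_rhs => rw [← cfc_id' ℝ X hX.isHermitian.isSelfAdjoint]
  refine cfc_congr fun x hx => ?_
  have := hX.spectrum_real_pos hx
  simp only [one_div, Real.rpow_inv_rpow this.le hr]

theorem mpow_mul_mpow_one_sub (hX : X.PosDef) (r : ℝ) : mpow X r * mpow X (1 - r) = X := by
  rw [mpow_eq_cfc hX.isHermitian, mpow_eq_cfc hX.isHermitian,
    ← cfc_mul _ _ X (Matrix.finite_real_spectrum.continuousOn _)
      (Matrix.finite_real_spectrum.continuousOn _)]
  conv_rhs => rw [← cfc_id' ℝ X hX.isHermitian.isSelfAdjoint]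
  refine cfc_congr fun x hx => ?_
  simp [← Real.rpow_add (hX.spectrum_real_pos hx)]

theorem tsallisRel_self (α : ℝ) (hX : X.PosDef) : tsallisRel α X X = 0 := by
  rw [tsallisRel, mpow_mul_mpow_one_sub hX]
  ring

theorem tsallisRel_nonneg {α : ℝ} (hα : 0 < α) (hα1 : α ≠ 1) (hX : X.PosDef) (hZ : Z.PosDef) :
    0 ≤ tsallisRel α X Z := by
  obtain ⟨w, hw, h⟩ := hX.isHermitian.exists_weights_trace_cfc_mul_cfc hZ.isHermitian
  have h1 := h (fun x => x) (fun _ => 1)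
  have h2 := h (fun _ => 1) (fun x => x)
  rw [cfc_id' ℝ X hX.isHermitian.isSelfAdjoint, cfc_const_one ℝ Z hZ.isHermitian.isSelfAdjoint, mul_one] at h1
  rw [cfc_id' ℝ Z hZ.isHermitian.isSelfAdjoint, cfc_const_one ℝ X hX.isHermitian.isSelfAdjoint, one_mul] at h2
  rw [tsallisRel, mpow_eq_cfc hX.isHermitian, mpow_eq_cfc hZ.isHermitian, h, h1, h2]
  simp only [Finset.mul_sum, ← Finset.sum_add_distrib, ← Finset.sum_sub_distrib, Finset.sum_div]
  refine Finset.sum_nonneg fun i _ => Finset.sum_nonneg fun j _ => ?_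
  convert mul_nonneg (hw i j)
    (rpow_mul_rpow_le_weighted_div hα hα1 (hX.eigenvalues_pos i) (hZ.eigenvalues_pos j)) using 1
  ring

end MatrixPower

/-- The power mean `M = ((X^α+Y^α)/2)^{1/α}` minimizes `Z ↦ S_α(X,Z) + S_α(Y,Z)` over `ℙ_d`. -/
theorem powerMean_minimizes_tsallisRel {d : ℕ} (α : ℝ) (hα : 0 < α) (hα1 : α ≠ 1)
    (X Y : Matrix (Fin d) (Fin d) ℂ) (hX : X.PosDef) (hY : Y.PosDef) :
    ∀ Z : Matrix (Fin d) (Fin d) ℂ, Z.PosDef →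
      tsallisRel α X (powerMean α X Y) + tsallisRel α Y (powerMean α X Y) ≤
        tsallisRel α X Z + tsallisRel α Y Z := by
  intro Z hZ
  have hN : ((1 / 2 : ℝ) • (mpow X α + mpow Y α)).PosDef :=
    ((hX.mpow α).add (hY.mpow α)).smul (by norm_num)
  have hM : (powerMean α X Y).PosDef := hN.mpow _
  have hpow : mpow (powerMean α X Y) α = (1 / 2 : ℝ) • (mpow X α + mpow Y α) :=
    mpow_one_div_mpow hN hα.ne'
  have pythagoras : ∀ W : Matrix (Fin d) (Fin d) ℂ, tsallisRel α X W + tsallisRel α Y W =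
      2 * tsallisRel α (powerMean α X Y) W +
        α * (X.trace.re + Y.trace.re - 2 * (powerMean α X Y).trace.re) / (1 - α) := by
    intro W
    simp only [tsallisRel, hpow, smul_mul_assoc, Matrix.add_mul, Matrix.trace_smul,
      Matrix.trace_add, Complex.smul_re, Complex.add_re, smul_eq_mul]
    ring
  rw [pythagoras, pythagoras, tsallisRel_self α hM]
  linarith [tsallisRel_nonneg hα hα1 hM hZ]
end
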